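/- Let G be a finite group, N ⊴ G a normal subgroup, σ an irreducible representation of N with inertia group I (the stabilizer of the isomorphism class of σ under the G-conjugation action). If θ is an irreducible representation of I whose restriction to N contains σ, then Ind_I^G θ is irreducible. -/

import Mathlib

/-- A finite-dimensional representation is irreducible if the space is nonzero and
the only invariant subspaces are `⊥` and `⊤`. -/
def IsIrreducibleRep {G V : Type*} [Group G] [AddCommGroup V] [Module ℂ V]
    (ρ : Representation ℂ G V) : Prop :=
  Nontrivial V ∧
    ∀ p : Submodule ℂ V, (∀ g : G, ∀ v ∈ p, ρ g v ∈ p) → p = ⊥ ∨ p = ⊤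

/-- The concrete model of the induced representation `Ind_I^G θ`: functions
`f : G → W` with `f (h * x) = θ h (f x)` for `h ∈ I`. -/
def inducedSpace {G : Type*} [Group G] (I : Subgroup G)
    {W : Type*} [AddCommGroup W] [Module ℂ W]
    (θ : Representation ℂ I W) : Submodule ℂ (G → W) where
  carrier := {f | ∀ (h : I) (x : G), f (h * x) = θ h (f x)}
  add_mem' := by intro a b ha hb h x; simp [ha h x, hb h x]
  zero_mem' := by intro h x; simp
  smul_mem' := by intro c a ha h x; simp [ha h x]

/-- The action of `G` on `Ind_I^G θ` by right translation, making it a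
representation of `G`. -/
def inducedRep {G : Type*} [Group G] (I : Subgroup G)
    {W : Type*} [AddCommGroup W] [Module ℂ W]
    (θ : Representation ℂ I W) : Representation ℂ G (inducedSpace I θ) where
  toFun g :=
    { toFun := fun p => ⟨fun x => p.1 (x * g), fun h x => by
        show p.1 (↑h * x * g) = θ h (p.1 (x * g))
        rw [mul_assoc]
        exact p.2 h (x * g)⟩
      map_add' := fun p q => rfl
      map_smul' := fun c p => rfl }
  map_one' := by
    apply LinearMap.ext; intro p
    exact Subtype.ext (funext fun x => by simp)
  map_mul' := fun g₁ g₂ => by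
    apply LinearMap.ext; intro p
    exact Subtype.ext (funext fun x => by
      show p.1 (x * (g₁ * g₂)) = p.1 (x * g₁ * g₂)
      rw [mul_assoc])

/-- Averaging a linear map over a finite group makes it equivariant. -/
lemma exists_average {K A B : Type*} [Group K] [Finite K] [AddCommGroup A] [Module ℂ A]
    [AddCommGroup B] [Module ℂ B] (ρA : Representation ℂ K A) (ρB : Representation ℂ K B)
    (T : B →ₗ[ℂ] A) :
    ∃ (S : B →ₗ[ℂ] A), (∀ k b, S (ρB k b) = ρA k (S b)) ∧
      (∀ (p : Submodule ℂ A), (∀ k, ∀ a ∈ p, ρA k a ∈ p) → (∀ b, T b ∈ p) → ∀ b, S b ∈ p) ∧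
      (∀ q : A →ₗ[ℂ] B, (∀ k a, q (ρA k a) = ρB k (q a)) → (∀ b, q (T b) = b) →
        ∀ b, q (S b) = b) ∧
      (∀ q : A →ₗ[ℂ] B, (∀ k a, q (ρA k a) = ρB k (q a)) → (∀ a, T (q a) = a) →
        ∀ a, S (q a) = a) := by
  classical
  have := Fintype.ofFinite K
  have hc : (Fintype.card K : ℂ) ≠ 0 := by
    exact_mod_cast Fintype.card_ne_zero
  have hinvA : ∀ k a, ρA k (ρA k⁻¹ a) = a := by
    intro k a
    rw [← Module.End.mul_apply, ← map_mul]; simp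
  have hinvB : ∀ k a, ρB k (ρB k⁻¹ a) = a := by
    intro k a
    rw [← Module.End.mul_apply, ← map_mul]; simp
  let S : B →ₗ[ℂ] A := (Fintype.card K : ℂ)⁻¹ • ∑ k : K, (ρA k) ∘ₗ T ∘ₗ (ρB k⁻¹)
  have hS : ∀ b, S b = (Fintype.card K : ℂ)⁻¹ • ∑ k : K, ρA k (T (ρB k⁻¹ b)) := by
    intro b; simp [S]
  refine ⟨S, ?_, ?_, ?_, ?_⟩
  · intro k b
    rw [hS, hS, map_smul, map_sum]
    congr 1
    rw [← Equiv.sum_comp (Equiv.mulLeft k)]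
    refine Finset.sum_congr rfl fun x _ => ?_
    simp only [Equiv.coe_mulLeft, mul_inv_rev, map_mul, Module.End.mul_apply]
    congr 4
    rw [← Module.End.mul_apply, ← map_mul]; simp
  · intro p hp hT b
    rw [hS]
    exact p.smul_mem _ (p.sum_mem fun k _ => hp _ _ (hT _))
  · intro q hq hT b
    rw [hS, map_smul, map_sum]
    simp only [hq, hT, hinvB]
    simp [← Nat.cast_smul_eq_nsmul ℂ, smul_smul, hc]
  · intro q hq hT a
    rw [hS]
    simp only [← hq, hT, hinvA]
    simp [← Nat.cast_smul_eq_nsmul ℂ, smul_smul, hc]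

lemma rep_inv_apply {K A : Type*} [Group K] [AddCommGroup A] [Module ℂ A]
    (ρ : Representation ℂ K A) (k : K) (a : A) : ρ k⁻¹ (ρ k a) = a := by
  rw [← Module.End.mul_apply, ← map_mul]; simp

/-- Clifford theory: Let `G` be a finite group, `N ⊴ G`, and `σ` an
irreducible representation of `N` with inertia group `I` (i.e. `I` consists of
exactly those `g ∈ G` for which the conjugate representation `σ^g` is isomorphic
to `σ`).  If `θ` is an irreducible representation of `I` whose restriction to `N`
contains `σ`, then `Ind_I^G θ` is irreducible. -/
theorem clifford_induced_irreducible (G : Type*) [Group G] [Fintype G]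
    (N : Subgroup G) (hN : N.Normal)
    (V : Type*) [AddCommGroup V] [Module ℂ V] [FiniteDimensional ℂ V]
    (σ : Representation ℂ N V) (hσ : IsIrreducibleRep σ)
    (I : Subgroup G) (hNI : N ≤ I)
    (hI : ∀ g : G, g ∈ I ↔
      ∃ T : V ≃ₗ[ℂ] V, ∀ n : N,
        (T : V →ₗ[ℂ] V) ∘ₗ σ n = σ ⟨g * n * g⁻¹, hN.conj_mem n n.2 g⟩ ∘ₗ T)
    (W : Type*) [AddCommGroup W] [Module ℂ W] [FiniteDimensional ℂ W]
    (θ : Representation ℂ I W) (hθ : IsIrreducibleRep θ)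
    (hres : ∃ ψ : V →ₗ[ℂ] W, Function.Injective ψ ∧
      ∀ n : N, ψ ∘ₗ σ n = θ ⟨n, hNI n.2⟩ ∘ₗ ψ) :
    IsIrreducibleRep (inducedRep I θ) := by
  classical
  obtain ⟨ψ, hψi, hψ⟩ := hres
  have hψ' : ∀ (n : N) (v : V), ψ (σ n v) = θ ⟨n, hNI n.2⟩ (ψ v) := fun n v =>
    LinearMap.congr_fun (hψ n) v
  obtain ⟨hVn, hVs⟩ := hσ
  obtain ⟨hWn, hWs⟩ := hθ
  let θN : Representation ℂ N W := θ.comp (Subgroup.inclusion hNI)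
  have hθN : ∀ n : N, θN n = θ ⟨n, hNI n.2⟩ := fun n => rfl
  -- Schur's lemma for the conjugates of `σ`
  have schur : ∀ z : G, z ∉ I → ∀ P : V →ₗ[ℂ] V,
      (∀ (n : N) (v : V), P (σ n v) = σ ⟨z * n * z⁻¹, hN.conj_mem n n.2 z⟩ (P v)) → P = 0 := by
    intro z hz P hP
    rcases hVs (LinearMap.ker P) (by
      intro n v hv
      rw [LinearMap.mem_ker] at hv ⊢
      rw [hP, hv, map_zero]) with h | h
    · exfalso
      apply hz
      rw [hI]
      have hinj : Function.Injective P := LinearMap.ker_eq_bot.mp h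
      refine ⟨LinearEquiv.ofInjectiveEndo P hinj, fun n => ?_⟩
      ext v
      simpa using hP n v
    · exact LinearMap.ker_eq_top.mp h
  -- an `N`-equivariant retraction of `ψ`
  obtain ⟨π0, hπ0⟩ := LinearMap.exists_leftInverse_of_injective ψ (LinearMap.ker_eq_bot.mpr hψi)
  obtain ⟨π, hπe, -, -, hπr⟩ := exists_average σ θN π0
  replace hπr := hπr ψ hψ' (fun a => LinearMap.congr_fun hπ0 a)
  -- the images of the translates of `ψ` span `W`
  have hspan : ∀ q : Submodule ℂ W, (∀ (h : I) (v : V), θ h (ψ v) ∈ q) → q = ⊤ := by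
    intro q hq
    let q' : Submodule ℂ W := Submodule.span ℂ {w | ∃ (h : I) (v : V), w = θ h (ψ v)}
    have hle : q' ≤ q := by
      apply Submodule.span_le.mpr
      rintro w ⟨h, v, rfl⟩
      exact hq h v
    rcases hWs q' (by
      intro g w hw
      induction hw using Submodule.span_induction with
      | mem x hx =>
        obtain ⟨h, v, rfl⟩ := hx
        apply Submodule.subset_span
        exact ⟨g * h, v, by rw [map_mul]; rfl⟩
      | zero => rw [map_zero]; exact q'.zero_mem
      | add x y _ _ hx hy => rw [map_add]; exact q'.add_mem hx hy
      | smul a x _ hx => rw [map_smul]; exact q'.smul_mem _ hx) with h | h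
    · exfalso
      obtain ⟨v, hv⟩ := exists_ne (0 : V)
      have : ψ v ∈ q' := Submodule.subset_span ⟨1, v, by simp⟩
      rw [h, Submodule.mem_bot] at this
      exact hv (hψi (by rw [this, map_zero]))
    · exact top_le_iff.mp (h ▸ hle)
  -- the translates of `π` separate points
  have hsep : ∀ w : W, (∀ h : I, π (θ h w) = 0) → w = 0 := by
    let q : Submodule ℂ W := ⨅ h : I, LinearMap.ker (π ∘ₗ θ h)
    have hq : ∀ w, w ∈ q ↔ ∀ h : I, π (θ h w) = 0 := by
      intro w; simp [q, Submodule.mem_iInf]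
    rcases hWs q (by
      intro g w hw
      rw [hq] at hw ⊢
      intro h
      have := hw (h * g)
      rwa [map_mul] at this) with h | h
    · intro w hw
      have := (hq w).mpr hw
      rwa [h, Submodule.mem_bot] at this
    · exfalso
      obtain ⟨v, hv⟩ := exists_ne (0 : V)
      have : ψ v ∈ q := h ▸ Submodule.mem_top
      have := (hq _).mp this 1
      rw [map_one, Module.End.one_apply, hπr] at this
      exact hv this
  -- conjugation formula for `θ`
  have hconj : ∀ (h : I) (n : N) (w : W), θ h (θN n w) =
      θN ⟨h * n * (h : G)⁻¹, hN.conj_mem n n.2 h⟩ (θ h w) := by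
    intro h n w
    rw [hθN, hθN, ← Module.End.mul_apply, ← Module.End.mul_apply, ← map_mul, ← map_mul]
    congr 2
    ext
    simp
  -- no `N`-maps from `W` to its conjugates outside `I`
  have hzero : ∀ x : G, x ∉ I → ∀ L : W →ₗ[ℂ] W,
      (∀ (n : N) (w : W), L (θN n w) = θN ⟨x * n * x⁻¹, hN.conj_mem n n.2 x⟩ (L w)) →
      L = 0 := by
    intro x hx L hL
    apply LinearMap.ker_eq_top.mp
    apply hspan
    intro h v
    rw [LinearMap.mem_ker]
    apply hsep
    intro k
    have hz : (k : G) * x * h ∉ I := by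
      intro hm
      apply hx
      have := I.mul_mem (I.mul_mem (I.inv_mem k.2) hm) (I.inv_mem h.2)
      simpa [mul_assoc] using this
    have := schur _ hz (π ∘ₗ θ k ∘ₗ L ∘ₗ θ h ∘ₗ ψ) (by
      intro n v
      simp only [LinearMap.comp_apply]
      rw [hψ', ← hθN, hconj, hL, hconj, hπe]
      congr 2
      ext
      simp [mul_assoc])
    exact LinearMap.congr_fun this v
  have hρ : ∀ (g : G) (f : inducedSpace I θ) (x : G), (inducedRep I θ g f).1 x = f.1 (x * g) :=
    fun _ _ _ => rfl
  let ev : inducedSpace I θ →ₗ[ℂ] W := (LinearMap.proj (1 : G)) ∘ₗ (inducedSpace I θ).subtype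
  have hev : ∀ f, ev f = f.1 1 := fun _ => rfl
  have hevI : ∀ (h : I) f, ev (inducedRep I θ h f) = θ h (ev f) := by
    intro h f
    rw [hev, hev, hρ, ← f.2 h 1]
    simp
  constructor
  · obtain ⟨w, hw⟩ := exists_ne (0 : W)
    let f : inducedSpace I θ := ⟨fun x => if hx : x ∈ I then θ ⟨x, hx⟩ w else 0, by
      intro h x
      by_cases hx : x ∈ I
      · have hm : (h : G) * x ∈ I := I.mul_mem h.2 hx
        simp only [hx, hm, dif_pos]
        rw [← Module.End.mul_apply, ← map_mul]
        rfl
      · have hm : (h : G) * x ∉ I := fun hm => hx ((I.mul_mem_cancel_left h.2).mp hm)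
        simp [hx, hm]⟩
    refine ⟨f, 0, fun h => hw ?_⟩
    have h1 : ev f = w := by
      rw [hev]
      simp only [f, I.one_mem, dif_pos]
      exact LinearMap.congr_fun (map_one θ) w
    rw [← h1, h, map_zero]
  · intro p hp
    by_cases hbot : p = ⊥
    · exact Or.inl hbot
    right
    obtain ⟨f, hfp, hf0⟩ := Submodule.exists_mem_ne_zero_of_ne_bot hbot
    have : ∃ x, f.1 x ≠ 0 := by
      by_contra! hcon
      exact hf0 (Subtype.ext (funext hcon))
    obtain ⟨x, hx⟩ := this
    -- evaluation at `1` maps `p` onto `W`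
    have hsurj : p.map ev = ⊤ := by
      refine (hWs (p.map ev) ?_).resolve_left ?_
      · rintro h _ ⟨f, hf, rfl⟩
        exact ⟨_, hp h f hf, hevI h f⟩
      · intro hb
        have : ev (inducedRep I θ x f) ∈ p.map ev := Submodule.mem_map_of_mem (hp x f hfp)
        rw [hb, Submodule.mem_bot, hev, hρ, one_mul] at this
        exact hx this
    have hs0 : ∃ s0 : W →ₗ[ℂ] p, (ev ∘ₗ p.subtype) ∘ₗ s0 = LinearMap.id := by
      apply LinearMap.exists_rightInverse_of_surjective
      rw [LinearMap.range_comp, Submodule.range_subtype, hsurj]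
    obtain ⟨s0, hs0⟩ := hs0
    obtain ⟨s, hse, hsp, hsr, -⟩ := exists_average ((inducedRep I θ).comp N.subtype) θN
      (p.subtype ∘ₗ s0)
    replace hsp := hsp p (fun k a ha => hp k a ha) (fun b => (s0 b).2)
    replace hsr := hsr ev (fun k a => hevI ⟨k, hNI k.2⟩ a) (fun b => LinearMap.congr_fun hs0 b)
    have hsupp : ∀ y : G, y ∉ I → ∀ w, (s w).1 y = 0 := by
      intro y hy w
      refine LinearMap.congr_fun (hzero y hy
        (LinearMap.proj y ∘ₗ (inducedSpace I θ).subtype ∘ₗ s) ?_) w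
      intro n w
      show (s (θN n w)).1 y = θN _ ((s w).1 y)
      rw [hse]
      show (s w).1 (y * n) = _
      rw [hθN, ← (s w).2]
      simp
    have hval : ∀ (h : I) w, (s w).1 h = θ h w := by
      intro h w
      have := (s w).2 h 1
      rw [mul_one, ← hev, hsr] at this
      exact this
    rw [eq_top_iff]
    rintro F -
    let c : ℂ := ∑ z : G, if z ∈ I then 1 else 0
    have hc : c ≠ 0 := by
      simp only [c, Finset.sum_boole]
      have : 0 < (Finset.univ.filter (fun z : G => z ∈ I)).card :=
        Finset.card_pos.mpr ⟨1, by simp⟩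
      exact_mod_cast this.ne'
    have hF : c • F = ∑ z : G, inducedRep I θ z⁻¹ (s (F.1 z)) := by
      apply Subtype.ext
      funext y
      rw [Submodule.coe_sum, Finset.sum_apply]
      simp only [hρ]
      show c • F.1 y = _
      rw [Finset.sum_smul, ← Equiv.sum_comp ((Equiv.inv G).trans (Equiv.mulLeft y))]
      refine Finset.sum_congr rfl fun z _ => ?_
      simp only [Equiv.trans_apply, Equiv.inv_apply, Equiv.coe_mulLeft]
      by_cases hz : y * z⁻¹ ∈ I
      · rw [if_pos hz, one_smul, hval ⟨_, hz⟩, ← F.2]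
        simp
      · rw [if_neg hz, zero_smul, hsupp _ hz]
    have : c • F ∈ p := hF ▸ p.sum_mem fun z _ => hp _ _ (hsp _)
    exact (p.smul_mem_iff hc).mp this
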